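/- Limit of the residual (Lemma: limit of residual). Assume 0 < η_g < 1/(2L), uniformly bounded gradients (‖∇f_i(w)‖ ≤ B for all i, w), uniformly lower-bounded losses (f_i(w) ≥ f_low for all i, w), and existence of a cluster point along a subsequence (t^j). Then the residual r_t := D_t − D(w*, (w_i*), (γ_i*)) satisfies: (i) r_t ≥ 0 for every t ≥ 1, and (ii) r_t → 0 as t → ∞. -/

import Mathlib

open Filter Topology Finset MeasureTheory RealInnerProductSpace

noncomputable section

abbrev Vec (d : ℕ) := EuclideanSpace ℝ (Fin d)

def subgrad {d : ℕ} (R : Vec d → ℝ) (x : Vec d) : Set (Vec d) :=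
  {g | ∀ y, R x + ⟪g, y - x⟫ ≤ R y}

def potD {d M : ℕ} (ηg : ℝ) (f : Fin M → Vec d → ℝ) (R : Vec d → ℝ)
    (x : Vec d) (y γv : Fin M → Vec d) : ℝ :=
  (M : ℝ)⁻¹ * ∑ i, f i (y i) + R x + (M : ℝ)⁻¹ * ∑ i, ⟪γv i, x - y i⟫
    + (M : ℝ)⁻¹ * ∑ i, (2 * ηg)⁻¹ * ‖x - y i‖ ^ 2

section Gradient

variable {E : Type*} [NormedAddCommGroup E] [InnerProductSpace ℝ E] [CompleteSpace E]

/-- Quadratic lower bound for a function with Lipschitz gradient. -/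
theorem quadratic_lower_bound_of_lipschitz_gradient {f : E → ℝ} {f' : E → E} {L : ℝ}
    (hgrad : ∀ x, HasGradientAt f (f' x) x)
    (hlip : ∀ x y, ‖f' x - f' y‖ ≤ L * ‖x - y‖) (x y : E) :
    f x + ⟪f' x, y - x⟫ - L / 2 * ‖y - x‖ ^ 2 ≤ f y := by
  set φ : ℝ → ℝ := fun s =>
    f (x + s • (y - x)) - s * ⟪f' x, y - x⟫ + L / 2 * ‖y - x‖ ^ 2 * s ^ 2 with hφ
  have hderiv (s : ℝ) : HasDerivAt φ
      (⟪f' (x + s • (y - x)), y - x⟫ - ⟪f' x, y - x⟫ + L * ‖y - x‖ ^ 2 * s) s := by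
    have hline : HasDerivAt (fun s : ℝ => x + s • (y - x)) (y - x) s := by
      simpa using ((hasDerivAt_id s).smul_const (y - x)).const_add x
    have hcomp := (hgrad (x + s • (y - x))).hasFDerivAt.comp_hasDerivAt s hline
    have hlin : HasDerivAt (fun s : ℝ => s * ⟪f' x, y - x⟫) ⟪f' x, y - x⟫ s := by
      simpa using (hasDerivAt_id s).mul_const ⟪f' x, y - x⟫
    have hsq : HasDerivAt (fun s : ℝ => L / 2 * ‖y - x‖ ^ 2 * s ^ 2)
        (L * ‖y - x‖ ^ 2 * s) s := by
      convert! (hasDerivAt_pow 2 s).const_mul (L / 2 * ‖y - x‖ ^ 2) using 1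
      norm_num
      ring
    convert! (hcomp.sub hlin).add hsq using 1
  have hmono : MonotoneOn φ (Set.Ici 0) := by
    refine monotoneOn_of_deriv_nonneg (convex_Ici 0)
      (fun s _ => (hderiv s).continuousAt.continuousWithinAt)
      (fun s _ => (hderiv s).differentiableAt.differentiableWithinAt) fun s hs => ?_
    rw [interior_Ici, Set.mem_Ioi] at hs
    rw [(hderiv s).deriv, ← inner_sub_left]
    have hinner := (abs_le.mp (abs_real_inner_le_norm (f' (x + s • (y - x)) - f' x) (y - x))).1
    have hnorm := hlip (x + s • (y - x)) x
    rw [add_sub_cancel_left, norm_smul, Real.norm_of_nonneg hs.le] at hnorm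
    nlinarith [mul_le_mul_of_nonneg_right hnorm (norm_nonneg (y - x))]
  have h := hmono (Set.mem_Ici.mpr le_rfl) (Set.mem_Ici.mpr zero_le_one) zero_le_one
  simp only [hφ, zero_smul, one_smul, add_zero, add_sub_cancel] at h
  linarith

/-- First-order optimality of a proximal step with a linear tilt. -/
theorem gradient_eq_of_isMin_proximal {f : E → ℝ} {g γ x y : E} {η : ℝ}
    (hgrad : HasGradientAt f g y)
    (hmin : ∀ v, f y - ⟪γ, y⟫ + (2 * η)⁻¹ * ‖x - y‖ ^ 2
      ≤ f v - ⟪γ, v⟫ + (2 * η)⁻¹ * ‖x - v‖ ^ 2) :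
    g = γ + η⁻¹ • (x - y) := by
  have hlin : HasFDerivAt (fun v => ⟪γ, v⟫) (innerSL ℝ γ) y := (innerSL ℝ γ).hasFDerivAt
  have hsq := (((hasFDerivAt_id (𝕜 := ℝ) y).const_sub x).norm_sq).const_mul (2 * η)⁻¹
  have hzero := IsLocalMin.hasFDerivAt_eq_zero (f := fun v =>
    f v - ⟪γ, v⟫ + (2 * η)⁻¹ * ‖x - v‖ ^ 2) (Eventually.of_forall hmin)
    ((hgrad.hasFDerivAt.sub hlin).add hsq)
  refine ext_inner_right ℝ fun u => ?_
  have hu := congrArg (fun T : E →L[ℝ] ℝ => T u) hzero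
  simp at hu
  rw [inner_add_left, real_inner_smul_left, inner_sub_left]
  linarith

/-- A primal-dual update of one client does not increase its augmented Lagrangian when the
dual variable tracks the gradient and the step size is small. -/
theorem client_lagrangian_le {f : E → ℝ} {f' : E → E} {L η : ℝ}
    (hL : 0 < L) (hη : 0 < η) (hη' : η < 1 / (2 * L))
    (hgrad : ∀ x, HasGradientAt f (f' x) x)
    (hlip : ∀ x y, ‖f' x - f' y‖ ≤ L * ‖x - y‖) {x y y' : E}
    (hupdate : f' y' = f' y + η⁻¹ • (x - y')) :
    f y' + ⟪f' y', x - y'⟫ + (2 * η)⁻¹ * ‖x - y'‖ ^ 2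
      ≤ f y + ⟪f' y, x - y⟫ + (2 * η)⁻¹ * ‖x - y‖ ^ 2 := by
  have hx' : x - y' = η • (f' y' - f' y) := by
    rw [hupdate, add_sub_cancel_left, smul_inv_smul₀ hη.ne']
  have hx : x - y = η • (f' y' - f' y) - (y - y') := by rw [← hx']; abel
  have hlower := quadratic_lower_bound_of_lipschitz_gradient hgrad hlip y' y
  have hδ : ‖f' y' - f' y‖ ^ 2 ≤ L ^ 2 * ‖y - y'‖ ^ 2 := by
    rw [← mul_pow, norm_sub_rev y]
    gcongr
    exact hlip y' y
  have hstep : L / 2 + η * L ^ 2 ≤ (2 * η)⁻¹ := by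
    have hηL : η * (2 * L) < 1 := (lt_div_iff₀ (by positivity)).mp hη'
    rw [← one_div, le_div_iff₀ (by positivity)]
    nlinarith [mul_pos hη hL]
  have hgap : (L / 2 + η * L ^ 2) * ‖y - y'‖ ^ 2 ≤ (2 * η)⁻¹ * ‖y - y'‖ ^ 2 := by gcongr
  have hηδ := mul_le_mul_of_nonneg_left hδ hη.le
  have hexp : ⟪f' y, x - y⟫ + (2 * η)⁻¹ * ‖x - y‖ ^ 2
      = ⟪f' y', x - y'⟫ + (2 * η)⁻¹ * ‖x - y'‖ ^ 2 - ⟪f' y', y - y'⟫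
        + (2 * η)⁻¹ * ‖y - y'‖ ^ 2 - η * ‖f' y' - f' y‖ ^ 2 := by
    rw [hx, hx', norm_sub_sq_real, ← real_inner_self_eq_norm_sq (f' y' - f' y)]
    simp only [inner_sub_left, inner_sub_right, real_inner_smul_left, real_inner_smul_right]
    rw [real_inner_comm (f' y') (f' y)]
    field_simp
    ring
  linarith

end Gradient

theorem mean_norm_sub_sq {E ι : Type*} [NormedAddCommGroup E] [InnerProductSpace ℝ E]
    [Fintype ι] {m : ℝ} (hm : m * Fintype.card ι = 1) (x : E) (y : ι → E) :
    m * ∑ i, ‖x - y i‖ ^ 2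
      = ‖x - m • ∑ i, y i‖ ^ 2 + (m * ∑ i, ‖y i‖ ^ 2 - ‖m • ∑ i, y i‖ ^ 2) := by
  simp only [norm_sub_sq_real, sum_add_distrib, sum_sub_distrib, ← mul_sum,
    real_inner_smul_right, inner_sum, sum_const, card_univ, nsmul_eq_mul]
  linear_combination ‖x‖ ^ 2 * hm

/-- The potential as a function of the server variable, up to a constant. -/
theorem potD_eq_server_objective {d M : ℕ} (hM : 1 ≤ M) (η : ℝ) (f : Fin M → Vec d → ℝ)
    (R : Vec d → ℝ) (x : Vec d) (y γ : Fin M → Vec d) :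
    potD η f R x y γ = R x + (M : ℝ)⁻¹ * ∑ i, ⟪γ i, x⟫
        + (2 * η)⁻¹ * ‖x - (M : ℝ)⁻¹ • ∑ i, y i‖ ^ 2
      + ((M : ℝ)⁻¹ * ∑ i, f i (y i) - (M : ℝ)⁻¹ * ∑ i, ⟪γ i, y i⟫
        + (2 * η)⁻¹ * ((M : ℝ)⁻¹ * ∑ i, ‖y i‖ ^ 2 - ‖(M : ℝ)⁻¹ • ∑ i, y i‖ ^ 2)) := by
  have hm : (M : ℝ)⁻¹ * Fintype.card (Fin M) = 1 := by
    rw [Fintype.card_fin]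
    exact inv_mul_cancel₀ (by positivity)
  have hmean := mean_norm_sub_sq hm x y
  simp only [potD, inner_sub_right, sum_sub_distrib, ← mul_sum]
  linear_combination (2 * η)⁻¹ * hmean

theorem potD_le_of_client_le {d M : ℕ} {η : ℝ} {f : Fin M → Vec d → ℝ}
    {R : Vec d → ℝ} {x : Vec d} {y y' γ γ' : Fin M → Vec d}
    (h : ∀ i, f i (y' i) + ⟪γ' i, x - y' i⟫ + (2 * η)⁻¹ * ‖x - y' i‖ ^ 2
      ≤ f i (y i) + ⟪γ i, x - y i⟫ + (2 * η)⁻¹ * ‖x - y i‖ ^ 2) :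
    potD η f R x y' γ' ≤ potD η f R x y γ := by
  have hsum := mul_le_mul_of_nonneg_left (sum_le_sum fun i (_ : i ∈ univ) => h i)
    (inv_nonneg.mpr (Nat.cast_nonneg (α := ℝ) M))
  simp only [sum_add_distrib, mul_add] at hsum
  simp only [potD]
  linarith

theorem tendsto_potD {α : Type*} {l : Filter α} {d M : ℕ} {η : ℝ} {f : Fin M → Vec d → ℝ}
    {R : Vec d → ℝ} (hf : ∀ i, Continuous (f i)) (hR : Continuous R)
    {x : α → Vec d} {y γ : Fin M → α → Vec d} {x₀ : Vec d} {y₀ γ₀ : Fin M → Vec d}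
    (hx : Tendsto x l (𝓝 x₀)) (hy : ∀ i, Tendsto (y i) l (𝓝 (y₀ i)))
    (hγ : ∀ i, Tendsto (γ i) l (𝓝 (γ₀ i))) :
    Tendsto (fun a => potD η f R (x a) (fun i => y i a) (fun i => γ i a)) l
      (𝓝 (potD η f R x₀ y₀ γ₀)) := by
  refine Tendsto.add (Tendsto.add (Tendsto.add ?_ ((hR.tendsto _).comp hx)) ?_) ?_
  · exact (tendsto_finsetSum _ fun i _ => ((hf i).tendsto _).comp (hy i)).const_mul _
  · exact (tendsto_finsetSum _ fun i _ => (hγ i).inner (hx.sub (hy i))).const_mul _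
  · exact (tendsto_finsetSum _ fun i _ =>
      ((hx.sub (hy i)).norm.pow 2).const_mul _).const_mul _

theorem fedslr_limit_of_residual
    (d M : ℕ) (hd : 1 ≤ d) (hM : 1 ≤ M)
    (L ηg : ℝ) (hL : 0 < L) (hηg : 0 < ηg)
    (f : Fin M → Vec d → ℝ) (f' : Fin M → Vec d → Vec d)
    (hgrad : ∀ i x, HasGradientAt (f i) (f' i x) x)
    (hlip : ∀ i (x y : Vec d), ‖f' i x - f' i y‖ ≤ L * ‖x - y‖)
    (R : Vec d → ℝ) (hRconv : ConvexOn ℝ Set.univ R) (hRnn : ∀ x, 0 ≤ R x)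
    (w : ℕ → Vec d) (wi γi : Fin M → ℕ → Vec d)
    (hloc : ∀ i t (v : Vec d),
      f i (wi i (t+1)) - ⟪γi i t, wi i (t+1)⟫ + (2*ηg)⁻¹ * ‖w t - wi i (t+1)‖^2
        ≤ f i v - ⟪γi i t, v⟫ + (2*ηg)⁻¹ * ‖w t - v‖^2)
    (hdual : ∀ i t, γi i (t+1) = γi i t + ηg⁻¹ • (w t - wi i (t+1)))
    (hagg : ∀ t (v : Vec d), v ≠ w (t+1) →
      R (w (t+1)) + (M:ℝ)⁻¹ * ∑ i, ⟪γi i (t+1), w (t+1)⟫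
          + (2*ηg)⁻¹ * ‖w (t+1) - (M:ℝ)⁻¹ • ∑ i, wi i (t+1)‖^2
        < R v + (M:ℝ)⁻¹ * ∑ i, ⟪γi i (t+1), v⟫
          + (2*ηg)⁻¹ * ‖v - (M:ℝ)⁻¹ • ∑ i, wi i (t+1)‖^2)
    (hηg' : ηg < 1 / (2 * L))
    (B : ℝ) (hB : 0 < B) (hBgrad : ∀ i x, ‖f' i x‖ ≤ B)
    (flow : ℝ) (hflow : ∀ i x, flow ≤ f i x)
    (ts : ℕ → ℕ) (hts : StrictMono ts) (hts1 : 1 ≤ ts 0)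
    (wst : Vec d) (wist γist : Fin M → Vec d)
    (hclw : Tendsto (fun j => w (ts j)) atTop (𝓝 wst))
    (hclwi : ∀ i, Tendsto (fun j => wi i (ts j)) atTop (𝓝 (wist i)))
    (hclγ : ∀ i, Tendsto (fun j => γi i (ts j)) atTop (𝓝 (γist i)))
 :
    (∀ t : ℕ, 1 ≤ t → 0 ≤ (potD ηg f R (w t) (fun i => wi i t) (fun i => γi i t) - potD ηg f R wst wist γist)) ∧
    Tendsto (fun t : ℕ => (potD ηg f R (w t) (fun i => wi i t) (fun i => γi i t) - potD ηg f R wst wist γist)) atTop (𝓝 0) := by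
  set D : ℕ → ℝ := fun t => potD ηg f R (w t) (fun i => wi i t) (fun i => γi i t) with hD
  have hγgrad (i : Fin M) (t : ℕ) : γi i (t + 1) = f' i (wi i (t + 1)) := by
    rw [hdual, gradient_eq_of_isMin_proximal (hgrad i _) (hloc i t)]
  have hdescent (t : ℕ) : D (t + 1 + 1) ≤ D (t + 1) := by
    have hserver : D (t + 1 + 1) ≤ potD ηg f R (w (t + 1)) (fun i => wi i (t + 1 + 1))
        (fun i => γi i (t + 1 + 1)) := by
      rcases eq_or_ne (w (t + 1)) (w (t + 1 + 1)) with heq | hne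
      · simp only [hD, heq, le_refl]
      · simp only [hD, potD_eq_server_objective hM]
        linarith [hagg (t + 1) (w (t + 1)) hne]
    refine hserver.trans (potD_le_of_client_le fun i => ?_)
    have hupdate := hdual i (t + 1)
    simp only [hγgrad] at hupdate ⊢
    exact client_lagrangian_le hL hηg hηg' (hgrad i) (hlip i) hupdate
  have hanti : Antitone fun t => D (t + 1) := antitone_nat_of_succ_le hdescent
  have hts_pos (j : ℕ) : 1 ≤ ts j := hts1.trans (hts.monotone (Nat.zero_le j))
  have hsub : Tendsto (fun j => D (ts j)) atTop (𝓝 (potD ηg f R wst wist γist)) :=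
    tendsto_potD (fun i => continuous_iff_continuousAt.mpr fun x => (hgrad i x).continuousAt)
      hRconv.locallyLipschitz.continuous hclw hclwi hclγ
  have hlim : Tendsto D atTop (𝓝 (potD ηg f R wst wist γist)) := by
    rw [← tendsto_add_atTop_iff_nat 1,
      tendsto_iff_tendsto_subseq_of_antitone hanti
        ((tendsto_sub_atTop_nat 1).comp hts.tendsto_atTop)]
    simpa only [Function.comp_def, Nat.sub_add_cancel (hts_pos _)] using hsub
  refine ⟨fun t ht => ?_, ?_⟩
  · obtain ⟨s, rfl⟩ := Nat.exists_eq_add_of_le' ht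
    exact sub_nonneg.mpr (hanti.le_of_tendsto ((tendsto_add_atTop_iff_nat 1).mpr hlim) s)
  · simpa only [sub_self] using hlim.sub_const (potD ηg f R wst wist γist)
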